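/- (Abstract local interpolation estimate, interior case.) Let 0 < c ≤ C and for each i ∈ {1,…,d} let φ_i be an N-function that is C² on (0,∞), satisfies the Δ₂-condition with constant D, and is uniformly convex with constants c, C. Define ψ_i(t) = ∫₀ᵗ √(s φ_i'(s)) ds, V_i(s) = ψ_i'(|s|)s/|s| (V_i(0)=0), and V : ℝ^d → ℝ^d coordinatewise. Let T ⊆ 𝒩 ⊂ ℝ^d be bounded measurable sets with 0 < |T| ≤ |𝒩| ≤ K|T|. Let Π be a linear operator mapping continuously differentiable functions on ℝ^d to functions that are continuously differentiable on a neighborhood of T, such that: (i) (invariance) Π p = p on T for every affine function p : ℝ^d → ℝ; (ii) (orthotropic Orlicz stability) there is C_S > 0 such that for all C¹ functions v, all i ∈ {1,…,d}, and all a ≥ 0: ⨍_T (φ_i)_a(|∂_i Π v|) dx ≤ C_S ⨍_𝒩 (φ_i)_a(|∂_i v|) dx. Then there is a constant C', depending only on c, C, D, K, C_S, such that for every continuously differentiable w : ℝ^d → ℝ: ⨍_T |V(∇w) − V(∇Π w)|² dx ≤ C' · inf_{q ∈ ℝ^d} ⨍_𝒩 |V(∇w) − V(q)|² dx. -/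

import Mathlib

open MeasureTheory

/-- An N-function `Φ` with derivative `Φ'`: differentiable on `[0,∞)` with
`Φ(0) = 0`, `Φ(t) = ∫₀ᵗ Φ'(s) ds`, `Φ'` nondecreasing, right-continuous,
`Φ'(0) = 0` and `Φ'(t) > 0` for `t > 0`. -/
structure IsNFunction (Φ Φ' : ℝ → ℝ) : Prop where
  map_zero : Φ 0 = 0
  eq_integral : ∀ t : ℝ, 0 ≤ t → Φ t = ∫ s in (0:ℝ)..t, Φ' s
  deriv_zero : Φ' 0 = 0
  deriv_pos : ∀ t : ℝ, 0 < t → 0 < Φ' t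
  deriv_mono : MonotoneOn Φ' (Set.Ici 0)
  deriv_rightCont : ∀ t : ℝ, 0 ≤ t → ContinuousWithinAt Φ' (Set.Ici t) t

/-- The Δ₂-condition with constant `D`. -/
def Delta2 (Φ : ℝ → ℝ) (D : ℝ) : Prop := ∀ t : ℝ, 0 < t → Φ (2 * t) ≤ D * Φ t

/-- Uniform convexity with constants `c ≤ C`: `c Φ'(t) ≤ t Φ''(t) ≤ C Φ'(t)` for `t > 0`. -/
def UniformlyConvex (Φ' Φ'' : ℝ → ℝ) (c C : ℝ) : Prop :=
  ∀ t : ℝ, 0 < t → c * Φ' t ≤ t * Φ'' t ∧ t * Φ'' t ≤ C * Φ' t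

/-- Derivative of the shifted N-function: `Φ_a'(t) = (t/(a+t)) Φ'(a+t)`. -/
noncomputable def shiftDeriv (Φ' : ℝ → ℝ) (a t : ℝ) : ℝ := t / (a + t) * Φ' (a + t)

/-- The shifted N-function `Φ_a(t) = ∫₀ᵗ (s/(a+s)) Φ'(a+s) ds`. -/
noncomputable def shiftN (Φ' : ℝ → ℝ) (a t : ℝ) : ℝ := ∫ s in (0:ℝ)..t, shiftDeriv Φ' a s

/-- `ψ'(t) = √(t Φ'(t))`. -/
noncomputable def psiDeriv (Φ' : ℝ → ℝ) (t : ℝ) : ℝ := Real.sqrt (t * Φ' t)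

/-- `ψ(t) = ∫₀ᵗ √(s Φ'(s)) ds`. -/
noncomputable def psiOf (Φ' : ℝ → ℝ) (t : ℝ) : ℝ := ∫ s in (0:ℝ)..t, psiDeriv Φ' s

/-- `V(s) = ψ'(|s|) s/|s|` for `s ≠ 0`, `V(0) = 0`. -/
noncomputable def Vof (Φ' : ℝ → ℝ) (s : ℝ) : ℝ :=
  if s = 0 then 0 else psiDeriv Φ' |s| * s / |s|

/-- The `i`-th partial derivative via the Fréchet derivative. -/
noncomputable def pdI (d : ℕ) (i : Fin d) (f : (Fin d → ℝ) → ℝ) (x : Fin d → ℝ) : ℝ :=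
  fderiv ℝ f x (Pi.single i 1)

section ScalarEstimates

variable {f : ℝ → ℝ} {k : ℕ}

/-- The upper bound `t f'(t) ≤ m f(t)` makes `t ↦ f t / t ^ m` nonincreasing. -/
lemma mul_pow_le_mul_pow_of_mul_deriv_le {f' : ℝ → ℝ} {m : ℕ}
    (hderiv : ∀ t : ℝ, 0 < t → HasDerivAt f (f' t) t)
    (hle : ∀ t : ℝ, 0 < t → t * f' t ≤ m * f t) {s t : ℝ} (hs : 0 < s) (hst : s ≤ t) :
    f t * s ^ m ≤ f s * t ^ m := by
  have hd : ∀ x : ℝ, 0 < x → HasDerivAt (fun x => f x / x ^ m)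
      ((f' x * x ^ m - f x * (m * x ^ (m - 1))) / (x ^ m) ^ 2) x := fun x hx =>
    (hderiv x hx).div (hasDerivAt_pow m x) (pow_pos hx m).ne'
  have hanti : AntitoneOn (fun x => f x / x ^ m) (Set.Ioi 0) := by
    refine antitoneOn_of_deriv_nonpos (convex_Ioi 0)
      (fun x hx => (hd x hx).continuousAt.continuousWithinAt)
      (fun x hx => ?_) (fun x hx => ?_)
    · rw [interior_Ioi] at hx
      exact (hd x hx).differentiableAt.differentiableWithinAt
    · rw [interior_Ioi] at hx
      have hx0 : (0 : ℝ) < x := hx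
      rw [(hd x hx).deriv]
      refine div_nonpos_of_nonpos_of_nonneg ?_ (by positivity)
      rcases m with _ | m
      · have := hle x hx0
        simp only [Nat.cast_zero, zero_mul] at this
        have : f' x ≤ 0 := by
          by_contra! h
          exact absurd this (not_le.2 (mul_pos hx0 h))
        simpa using this
      · have h := mul_le_mul_of_nonneg_right (hle x hx0) (pow_nonneg hx0.le m)
        simp only [Nat.add_sub_cancel]
        rw [pow_succ]
        linarith
  have ht : 0 < t := hs.trans_le hst
  have h := hanti (Set.mem_Ioi.2 hs) (Set.mem_Ioi.2 ht) hst
  exact (div_le_div_iff₀ (pow_pos ht m) (pow_pos hs m)).1 h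

lemma Vof_of_nonneg {s : ℝ} (hs : 0 ≤ s) : Vof f s = √(s * f s) := by
  unfold Vof psiDeriv
  split_ifs with h
  · simp [h]
  · rw [abs_of_nonneg hs, mul_div_cancel_right₀ _ h]

lemma Vof_neg (s : ℝ) : Vof f (-s) = -Vof f s := by
  unfold Vof
  by_cases h : s = 0
  · simp [h]
  · simp [h, neg_div]

lemma monotone_Vof (h0 : f 0 = 0) (hmono : MonotoneOn f (Set.Ici 0)) : Monotone (Vof f) := by
  refine monotone_of_odd_of_monotoneOn_nonneg Vof_neg fun s hs t ht hst => ?_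
  rw [Vof_of_nonneg hs, Vof_of_nonneg ht]
  have hfs : 0 ≤ f s := h0 ▸ hmono Set.self_mem_Ici hs hs
  exact Real.sqrt_le_sqrt (mul_le_mul hst (hmono hs ht hst) hfs ht)

lemma mul_sqrt_div_self {t : ℝ} (ht : 0 < t) : t * √(f t / t) = √(t * f t) := by
  nth_rewrite 1 [← Real.sqrt_sq ht.le]
  rw [← Real.sqrt_mul (sq_nonneg t)]
  congr 1
  field_simp

lemma sub_mul_sqrt_div_le_Vof_sub (h0 : f 0 = 0) (hmono : MonotoneOn f (Set.Ici 0))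
    {s t : ℝ} (hs : 0 ≤ s) (hst : s ≤ t) (ht : 0 < t) :
    (t - s) * √(f t / t) ≤ 2 * (Vof f t - Vof f s) := by
  rw [Vof_of_nonneg hs, Vof_of_nonneg ht.le]
  have hft : 0 ≤ f t := h0 ▸ hmono Set.self_mem_Ici ht.le ht.le
  have hfs : f s ≤ f t := hmono hs ht.le hst
  have h1 : √(s * f s) ≤ √s * √(f t) := by
    rw [← Real.sqrt_mul hs]
    exact Real.sqrt_le_sqrt (mul_le_mul_of_nonneg_left hfs hs)
  have h2 : √(t * f t) = √t * √(f t) := Real.sqrt_mul ht.le _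
  have h3 : √s ≤ √t := Real.sqrt_le_sqrt hst
  have htp : 0 < √t := Real.sqrt_pos.2 ht
  rw [Real.sqrt_div hft, mul_div_assoc', div_le_iff₀ htp, h2]
  have hts : t - s = (√t - √s) * (√t + √s) := by
    nlinarith [Real.sq_sqrt hs, Real.sq_sqrt ht.le]
  have hF := Real.sqrt_nonneg (f t)
  calc (t - s) * √(f t) = ((√t - √s) * √(f t)) * (√t + √s) := by rw [hts]; ring
    _ ≤ ((√t - √s) * √(f t)) * (2 * √t) := by
        refine mul_le_mul_of_nonneg_left (by linarith) (mul_nonneg (by linarith) hF)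
    _ ≤ 2 * (√t * √(f t) - √(s * f s)) * √t := by nlinarith

lemma Vof_sub_le_sub_mul_sqrt_div (h0 : f 0 = 0) (hmono : MonotoneOn f (Set.Ici 0))
    (hdec : ∀ s t : ℝ, 0 < s → s ≤ t → f t * s ^ (2 * k + 1) ≤ f s * t ^ (2 * k + 1))
    {s t : ℝ} (hs : 0 ≤ s) (hst : s ≤ t) (ht : 0 < t) :
    Vof f t - Vof f s ≤ (k + 1) * ((t - s) * √(f t / t)) := by
  have hft : 0 ≤ f t := h0 ▸ hmono Set.self_mem_Ici ht.le ht.le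
  have hpow : (s / t) ^ (k + 1) * Vof f t ≤ Vof f s := by
    rw [Vof_of_nonneg hs, Vof_of_nonneg ht.le]
    refine Real.le_sqrt_of_sq_le ?_
    rw [mul_pow, Real.sq_sqrt (mul_nonneg ht.le hft)]
    rcases hs.eq_or_lt with rfl | hs'
    · simp
    · rw [div_pow, div_pow, div_mul_eq_mul_div, div_le_iff₀ (by positivity)]
      have := mul_le_mul_of_nonneg_left (hdec s t hs' hst) (mul_nonneg hs ht.le)
      calc (s ^ (k + 1)) ^ 2 * (t * f t) = s * t * (f t * s ^ (2 * k + 1)) := by ring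
        _ ≤ s * t * (f s * t ^ (2 * k + 1)) := this
        _ = s * f s * (t ^ (k + 1)) ^ 2 := by ring
  have hbern : 1 - (k + 1) * (1 - s / t) ≤ (s / t) ^ (k + 1) := by
    have hx : 0 ≤ s / t := by positivity
    have := one_add_mul_le_pow (a := s / t - 1) (by linarith) (k + 1)
    push_cast at this
    rw [show 1 + (s / t - 1) = s / t by ring] at this
    linarith
  have hV : Vof f t = t * √(f t / t) := by rw [mul_sqrt_div_self ht, Vof_of_nonneg ht.le]
  have hV0 : 0 ≤ Vof f t := by rw [Vof_of_nonneg ht.le]; positivity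
  have hmul := mul_le_mul_of_nonneg_right hbern hV0
  have heq : (1 - s / t) * Vof f t = (t - s) * √(f t / t) := by
    rw [hV]; field_simp
  rw [← heq]
  linarith

lemma Vof_sub_sq_bounds_of_abs_le (h0 : f 0 = 0) (hmono : MonotoneOn f (Set.Ici 0))
    (hk : 1 ≤ k)
    (hdec : ∀ s t : ℝ, 0 < s → s ≤ t → f t * s ^ (2 * k + 1) ≤ f s * t ^ (2 * k + 1))
    {P Q : ℝ} (hP : 0 < P) (hQ : |Q| ≤ P) :
    (P - Q) ^ 2 * (f P / P) ≤ 4 * (Vof f P - Vof f Q) ^ 2 ∧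
      (Vof f P - Vof f Q) ^ 2 ≤ (k + 1) ^ 2 * ((P - Q) ^ 2 * (f P / P)) := by
  have hfP : 0 ≤ f P := h0 ▸ hmono Set.self_mem_Ici hP.le hP.le
  have hH : 0 ≤ f P / P := by positivity
  have hQP : 0 ≤ P - Q := by linarith [le_abs_self Q]
  have hkR : (1 : ℝ) ≤ k := by exact_mod_cast hk
  suffices h : (P - Q) * √(f P / P) ≤ 2 * (Vof f P - Vof f Q) ∧
      Vof f P - Vof f Q ≤ (k + 1) * ((P - Q) * √(f P / P)) by
    have hsq : ((P - Q) * √(f P / P)) ^ 2 = (P - Q) ^ 2 * (f P / P) := by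
      rw [mul_pow, Real.sq_sqrt hH]
    have hnn : 0 ≤ (P - Q) * √(f P / P) := by positivity
    have h1 := pow_le_pow_left₀ hnn h.1 2
    have h2 := pow_le_pow_left₀ (by linarith [h.1] : 0 ≤ Vof f P - Vof f Q) h.2 2
    rw [← hsq]
    constructor
    · linarith
    · rwa [mul_pow] at h2
  rcases le_total 0 Q with hQ0 | hQ0
  · have hQP' : Q ≤ P := by linarith
    exact ⟨sub_mul_sqrt_div_le_Vof_sub h0 hmono hQ0 hQP' hP,
      Vof_sub_le_sub_mul_sqrt_div h0 hmono hdec hQ0 hQP' hP⟩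
  · rw [abs_of_nonpos hQ0] at hQ
    have hm := monotone_Vof h0 hmono
    have hV0 : Vof f 0 = 0 := by simp [Vof]
    have h1 : Vof f Q ≤ 0 := hV0 ▸ hm hQ0
    have h2 : -Vof f Q ≤ Vof f P := by rw [← Vof_neg]; exact hm hQ
    have hVP : Vof f P = P * √(f P / P) := by rw [mul_sqrt_div_self hP, Vof_of_nonneg hP.le]
    have hr := Real.sqrt_nonneg (f P / P)
    constructor
    · nlinarith
    · have h3 : Vof f P ≤ (P - Q) * √(f P / P) := by
        rw [hVP]; exact mul_le_mul_of_nonneg_right (by linarith) hr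
      nlinarith [mul_nonneg hQP hr]

lemma Vof_sub_sq_bounds (h0 : f 0 = 0) (hmono : MonotoneOn f (Set.Ici 0)) (hk : 1 ≤ k)
    (hdec : ∀ s t : ℝ, 0 < s → s ≤ t → f t * s ^ (2 * k + 1) ≤ f s * t ^ (2 * k + 1))
    {P Q : ℝ} (hM : 0 < max |P| |Q|) :
    (P - Q) ^ 2 * (f (max |P| |Q|) / max |P| |Q|) ≤ 4 * (Vof f P - Vof f Q) ^ 2 ∧
      (Vof f P - Vof f Q) ^ 2 ≤
        (k + 1) ^ 2 * ((P - Q) ^ 2 * (f (max |P| |Q|) / max |P| |Q|)) := by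
  wlog hQP : |Q| ≤ |P| generalizing P Q
  · have := this (P := Q) (Q := P) (by rwa [max_comm]) (not_le.1 hQP).le
    rwa [max_comm, sub_sq_comm Q P, sub_sq_comm (Vof f Q)] at this
  wlog hP : 0 ≤ P generalizing P Q
  · have := this (P := -P) (Q := -Q) (by simpa using hM) (by simpa using hQP)
      (by linarith [not_le.1 hP])
    rw [abs_neg, abs_neg, Vof_neg, Vof_neg] at this
    rwa [show (-P - -Q) ^ 2 = (P - Q) ^ 2 by ring,
      show (-Vof f P - -Vof f Q) ^ 2 = (Vof f P - Vof f Q) ^ 2 by ring] at this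
  rw [max_eq_left hQP, abs_of_nonneg hP] at hM ⊢
  rw [abs_of_nonneg hP] at hQP
  exact Vof_sub_sq_bounds_of_abs_le h0 hmono hk hdec hM hQP

lemma monotoneOn_shiftDeriv (h0 : f 0 = 0) (hmono : MonotoneOn f (Set.Ici 0)) {a : ℝ}
    (ha : 0 ≤ a) : MonotoneOn (shiftDeriv f a) (Set.Ici 0) := by
  intro s hs t ht hst
  have hs0 : (0 : ℝ) ≤ s := hs
  have ht0 : (0 : ℝ) ≤ t := ht
  have has : (0 : ℝ) ≤ a + s := by linarith
  have hat : (0 : ℝ) ≤ a + t := by linarith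
  have hfs : 0 ≤ f (a + s) := h0 ▸ hmono Set.self_mem_Ici has has
  unfold shiftDeriv
  refine mul_le_mul ?_ (hmono has hat (by linarith)) hfs (by positivity)
  rcases has.eq_or_lt with h | h
  · rw [← h, div_zero]; positivity
  · rw [div_le_div_iff₀ h (by linarith)]
    nlinarith

lemma shiftN_bounds (h0 : f 0 = 0) (hmono : MonotoneOn f (Set.Ici 0))
    (hdec : ∀ s t : ℝ, 0 < s → s ≤ t → f t * s ^ (2 * k + 1) ≤ f s * t ^ (2 * k + 1))
    {a t : ℝ} (ha : 0 ≤ a) (ht : 0 ≤ t) (hat : 0 < a + t) :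
    shiftN f a t ≤ t ^ 2 * (f (a + t) / (a + t)) ∧
      t ^ 2 * (f (a + t) / (a + t)) ≤ 4 * 2 ^ (2 * k + 1) * shiftN f a t := by
  have hm := monotoneOn_shiftDeriv h0 hmono ha
  have hint : ∀ x y : ℝ, 0 ≤ x → 0 ≤ y →
      IntervalIntegrable (shiftDeriv f a) volume x y := fun x y hx hy =>
    MonotoneOn.intervalIntegrable (hm.mono fun z hz => (le_inf hx hy).trans hz.1)
  have hft : 0 ≤ f (a + t) := h0 ▸ hmono Set.self_mem_Ici hat.le hat.le
  have hsd0 : shiftDeriv f a 0 = 0 := by simp [shiftDeriv]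
  constructor
  · have h := intervalIntegral.integral_mono_on ht (hint 0 t le_rfl ht)
      (intervalIntegrable_const (c := shiftDeriv f a t)) fun x hx => hm hx.1 ht hx.2
    rw [intervalIntegral.integral_const] at h
    unfold shiftN
    refine h.trans_eq ?_
    simp only [shiftDeriv, smul_eq_mul, sub_zero]
    ring
  · have ht2 : 0 ≤ t / 2 := by positivity
    have hsplit := intervalIntegral.integral_add_adjacent_intervals
      (hint 0 (t / 2) le_rfl ht2) (hint (t / 2) t ht2 ht)
    have h1 : 0 ≤ ∫ s in (0 : ℝ)..(t / 2), shiftDeriv f a s :=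
      intervalIntegral.integral_nonneg ht2 fun x hx =>
        hsd0 ▸ hm Set.self_mem_Ici (Set.mem_Ici.2 hx.1) hx.1
    have h2 := intervalIntegral.integral_mono_on (by linarith : t / 2 ≤ t)
      (intervalIntegrable_const (c := shiftDeriv f a (t / 2))) (hint (t / 2) t ht2 ht)
      fun x hx => hm ht2 (Set.mem_Ici.2 (ht2.trans hx.1)) hx.1
    rw [intervalIntegral.integral_const, smul_eq_mul] at h2
    have h3 : (t - t / 2) * shiftDeriv f a (t / 2) ≤ shiftN f a t := by
      unfold shiftN; linarith
    have har : 0 < a + t / 2 := by linarith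
    have hf2 : f (a + t) ≤ 2 ^ (2 * k + 1) * f (a + t / 2) := by
      have hd := hdec _ _ har (by linarith : a + t / 2 ≤ a + t)
      have hfr : 0 ≤ f (a + t / 2) := h0 ▸ hmono Set.self_mem_Ici har.le har.le
      have hp : (a + t) ^ (2 * k + 1) ≤ 2 ^ (2 * k + 1) * (a + t / 2) ^ (2 * k + 1) := by
        rw [← mul_pow]; exact pow_le_pow_left₀ hat.le (by linarith) _
      have hpp : 0 < (a + t / 2) ^ (2 * k + 1) := pow_pos har _
      refine le_of_mul_le_mul_right (hd.trans ?_) hpp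
      calc f (a + t / 2) * (a + t) ^ (2 * k + 1)
          ≤ f (a + t / 2) * (2 ^ (2 * k + 1) * (a + t / 2) ^ (2 * k + 1)) :=
            mul_le_mul_of_nonneg_left hp hfr
        _ = _ := by ring
    have h4 : t ^ 2 * (f (a + t) / (a + t)) ≤
        4 * 2 ^ (2 * k + 1) * ((t - t / 2) * shiftDeriv f a (t / 2)) := by
      calc t ^ 2 * (f (a + t) / (a + t))
          ≤ t ^ 2 * (f (a + t) / (a + t / 2)) := by
            gcongr; linarith
        _ ≤ t ^ 2 * ((2 ^ (2 * k + 1) * f (a + t / 2)) / (a + t / 2)) := by gcongr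
        _ = _ := by unfold shiftDeriv; ring
    exact h4.trans (mul_le_mul_of_nonneg_left h3 (by positivity))

/-- The equivalence `Φ_{|Q|}(|P - Q|) ∼ |V(P) - V(Q)|²`. -/
lemma shiftN_equiv_Vof_sub_sq (h0 : f 0 = 0) (hmono : MonotoneOn f (Set.Ici 0)) (hk : 1 ≤ k)
    (hdec : ∀ s t : ℝ, 0 < s → s ≤ t → f t * s ^ (2 * k + 1) ≤ f s * t ^ (2 * k + 1))
    (P Q : ℝ) :
    shiftN f |Q| |P - Q| ≤ 4 * 4 ^ (2 * k + 1) * (Vof f P - Vof f Q) ^ 2 ∧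
      (Vof f P - Vof f Q) ^ 2 ≤
        (k + 1) ^ 2 * 4 * (4 * 2 ^ (2 * k + 1)) * shiftN f |Q| |P - Q| := by
  rcases (le_max_of_le_left (abs_nonneg P) : 0 ≤ max |P| |Q|).eq_or_lt with hM | hM
  · have hP : P = 0 := abs_nonpos_iff.1 (hM ▸ le_max_left _ _)
    have hQ : Q = 0 := abs_nonpos_iff.1 (hM ▸ le_max_right _ _)
    simp [hP, hQ, shiftN]
  obtain ⟨hl, hu⟩ := Vof_sub_sq_bounds h0 hmono hk hdec hM
  set M := max |P| |Q| with hMdef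
  have hPM : |P| ≤ M := le_max_left _ _
  have hQM : |Q| ≤ M := le_max_right _ _
  have hMR : M ≤ |Q| + |P - Q| := by
    refine max_le ?_ (by linarith [abs_nonneg (P - Q)])
    have := abs_add_le Q (P - Q)
    rwa [add_sub_cancel] at this
  have hRM : |Q| + |P - Q| ≤ 4 * M := by linarith [abs_sub P Q]
  have hR : 0 < |Q| + |P - Q| := hM.trans_le hMR
  obtain ⟨sl, su⟩ := shiftN_bounds h0 hmono hdec (abs_nonneg Q) (abs_nonneg (P - Q)) hR
  rw [sq_abs] at sl su
  set R := |Q| + |P - Q| with hRdef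
  have hfM : 0 ≤ f M := h0 ▸ hmono Set.self_mem_Ici hM.le hM.le
  have hfR : 0 ≤ f R := h0 ▸ hmono Set.self_mem_Ici hR.le hR.le
  have hMR' : f M / M ≤ 4 * (f R / R) := by
    rw [← mul_div_assoc, div_le_div_iff₀ hM hR]
    have := hmono (Set.mem_Ici.2 hM.le) (Set.mem_Ici.2 hR.le) hMR
    nlinarith
  have hRM' : f R / R ≤ 4 ^ (2 * k + 1) * (f M / M) := by
    have hd := hdec _ _ hM hMR
    have hp : R ^ (2 * k + 1) ≤ 4 ^ (2 * k + 1) * M ^ (2 * k + 1) := by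
      rw [← mul_pow]; exact pow_le_pow_left₀ hR.le hRM _
    have hf : f R ≤ 4 ^ (2 * k + 1) * f M := by
      refine le_of_mul_le_mul_right (hd.trans ?_) (pow_pos hM (2 * k + 1))
      calc f M * R ^ (2 * k + 1) ≤ f M * (4 ^ (2 * k + 1) * M ^ (2 * k + 1)) :=
            mul_le_mul_of_nonneg_left hp hfM
        _ = _ := by ring
    calc f R / R ≤ f R / M := by gcongr
      _ ≤ (4 ^ (2 * k + 1) * f M) / M := by gcongr
      _ = _ := by ring
  constructor
  · calc shiftN f |Q| |P - Q| ≤ (P - Q) ^ 2 * (f R / R) := sl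
      _ ≤ (P - Q) ^ 2 * (4 ^ (2 * k + 1) * (f M / M)) := by gcongr
      _ = 4 ^ (2 * k + 1) * ((P - Q) ^ 2 * (f M / M)) := by ring
      _ ≤ 4 ^ (2 * k + 1) * (4 * (Vof f P - Vof f Q) ^ 2) := by gcongr
      _ = _ := by ring
  · calc (Vof f P - Vof f Q) ^ 2 ≤ (k + 1) ^ 2 * ((P - Q) ^ 2 * (f M / M)) := hu
      _ ≤ (k + 1) ^ 2 * ((P - Q) ^ 2 * (4 * (f R / R))) := by gcongr
      _ = (k + 1) ^ 2 * 4 * ((P - Q) ^ 2 * (f R / R)) := by ring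
      _ ≤ (k + 1) ^ 2 * 4 * (4 * 2 ^ (2 * k + 1) * shiftN f |Q| |P - Q|) := by gcongr
      _ = _ := by ring

end ScalarEstimates

lemma measurable_pdI {d : ℕ} (i : Fin d) (g : (Fin d → ℝ) → ℝ) : Measurable (pdI d i g) :=
  measurable_fderiv_apply_const ℝ g _

/-- The gradient of a function vanishes almost everywhere on a measurable set on which the
function vanishes. -/
lemma ae_pdI_eq_zero_of_eqOn_zero {d : ℕ} {T : Set (Fin d → ℝ)} (hT : MeasurableSet T)
    {g : (Fin d → ℝ) → ℝ} (hg : ∀ x ∈ T, DifferentiableAt ℝ g x) (hzero : ∀ x ∈ T, g x = 0)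
    (i : Fin d) : ∀ᵐ x ∂volume.restrict T, pdI d i g x = 0 := by
  let e : Fin d → ℝ := Pi.single i 1
  have happ : ApproximatesLinearOn (fun x => g x • e) (0 : (Fin d → ℝ) →L[ℝ] (Fin d → ℝ)) T 0 := by
    intro x hx y hy
    simp [hzero x hx, hzero y hy]
  have h := happ.norm_fderiv_sub_le volume hT (fun x => (fderiv ℝ g x).smulRight e)
    fun x hx => ((hg x hx).hasFDerivAt.smul_const e).hasFDerivWithinAt
  filter_upwards [h] with x hx
  have he : e ≠ 0 := by simp [e]
  have h0 : fderiv ℝ g x = 0 := by simpa [he] using hx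
  simp [pdI, h0]

lemma pdI_add {d : ℕ} (i : Fin d) {g h : (Fin d → ℝ) → ℝ} {x : Fin d → ℝ}
    (hg : DifferentiableAt ℝ g x) (hh : DifferentiableAt ℝ h x) :
    pdI d i (fun y => g y + h y) x = pdI d i g x + pdI d i h x := by
  simp [pdI, fderiv_fun_add hg hh]

lemma contDiff_sum_mul {d : ℕ} (q : Fin d → ℝ) :
    ContDiff ℝ 1 (fun y : Fin d → ℝ => ∑ j, q j * y j) := by
  fun_prop

lemma pdI_sum_mul {d : ℕ} (i : Fin d) (q x : Fin d → ℝ) :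
    pdI d i (fun y => ∑ j, q j * y j) x = q i := by
  have h : HasFDerivAt (fun y : Fin d → ℝ => ∑ j, q j * y j)
      (∑ j, q j • (ContinuousLinearMap.proj j : (Fin d → ℝ) →L[ℝ] ℝ)) x :=
    HasFDerivAt.fun_sum fun j _ => (hasFDerivAt_apply j x).const_mul (q j)
  simp [pdI, h.fderiv, Pi.single_apply]

/-- Affine invariance passes to gradients: subtracting a linear function with gradient `q`
before applying `Ph` shifts the gradient of the image by `q`, almost everywhere on `T`. -/
lemma ae_pdI_sub_linear {d : ℕ} {T : Set (Fin d → ℝ)} (hT : MeasurableSet T)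
    {Ph : ((Fin d → ℝ) → ℝ) → ((Fin d → ℝ) → ℝ)}
    (hlin : ∀ (a b : ℝ) (v₁ v₂ : (Fin d → ℝ) → ℝ), ContDiff ℝ 1 v₁ → ContDiff ℝ 1 v₂ →
      Ph (fun x => a * v₁ x + b * v₂ x) = fun x => a * Ph v₁ x + b * Ph v₂ x)
    (hreg : ∀ v : (Fin d → ℝ) → ℝ, ContDiff ℝ 1 v →
      ∃ U : Set (Fin d → ℝ), IsOpen U ∧ T ⊆ U ∧ ContDiffOn ℝ 1 (Ph v) U)
    (haff : ∀ (α : ℝ) (β : Fin d → ℝ), ∀ x ∈ T,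
      Ph (fun y => α + ∑ i, β i * y i) x = α + ∑ i, β i * x i)
    {w : (Fin d → ℝ) → ℝ} (hw : ContDiff ℝ 1 w) (q : Fin d → ℝ) (i : Fin d) :
    ∀ᵐ x ∂volume.restrict T,
      pdI d i (Ph fun y => w y - ∑ j, q j * y j) x = pdI d i (Ph w) x - q i := by
  set p : (Fin d → ℝ) → ℝ := fun y => ∑ j, q j * y j with hp
  have hpc : ContDiff ℝ 1 p := contDiff_sum_mul q
  have hdiff : ∀ v, ContDiff ℝ 1 v → ∀ x ∈ T, DifferentiableAt ℝ (Ph v) x := by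
    intro v hv x hx
    obtain ⟨U, hU, hTU, hc⟩ := hreg v hv
    exact (hc.contDiffAt (hU.mem_nhds (hTU hx))).differentiableAt one_ne_zero
  have hPv : (Ph fun y => w y - p y) = fun x => Ph w x + (-1) * Ph p x := by
    have := hlin 1 (-1) w p hw hpc
    simpa [sub_eq_add_neg] using this
  have hPp : ∀ x ∈ T, Ph p x = p x := by
    intro x hx
    have := haff 0 q x hx
    simpa using this
  have hpd : Differentiable ℝ p := hpc.differentiable one_ne_zero
  have hz := ae_pdI_eq_zero_of_eqOn_zero hT (g := fun x => p x + (-1) * Ph p x)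
    (fun x hx => (hpd x).add ((hdiff p hpc x hx).const_mul (-1)))
    (fun x hx => by rw [hPp x hx]; ring) i
  filter_upwards [hz, ae_restrict_mem hT] with x hx hxT
  have hPpx := (hdiff p hpc x hxT).const_mul (-1)
  rw [pdI_add i (hpd x) hPpx, hp, pdI_sum_mul] at hx
  rw [hPv, pdI_add i (hdiff w hw x hxT) hPpx]
  linarith

/-- Averages over a subset of comparable measure are controlled by averages over the full set. -/
lemma setLIntegral_div_le_of_subset {X : Type*} [MeasurableSpace X] {μ : Measure X}
    {S N : Set X} (hSN : S ⊆ N) {K : ℝ} (hK : 0 < K)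
    (hμ : μ N ≤ ENNReal.ofReal K * μ S) (F : X → ENNReal) :
    (∫⁻ x in S, F x ∂μ) / μ S ≤ ENNReal.ofReal K * ((∫⁻ x in N, F x ∂μ) / μ N) := by
  have hK0 : ENNReal.ofReal K ≠ 0 := (ENNReal.ofReal_pos.2 hK).ne'
  have hinv : (μ S)⁻¹ ≤ ENNReal.ofReal K * (μ N)⁻¹ := by
    have h : μ N / ENNReal.ofReal K ≤ μ S :=
      ENNReal.div_le_of_le_mul (by rwa [mul_comm])
    have h' := ENNReal.inv_le_inv.2 h
    rwa [ENNReal.inv_div (Or.inl ENNReal.ofReal_ne_top) (Or.inl hK0), div_eq_mul_inv] at h'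
  calc (∫⁻ x in S, F x ∂μ) / μ S ≤ (∫⁻ x in N, F x ∂μ) * (ENNReal.ofReal K * (μ N)⁻¹) := by
        rw [div_eq_mul_inv]
        exact mul_le_mul' (lintegral_mono_set hSN) hinv
    _ = _ := by rw [div_eq_mul_inv]; ring

/-- abstract local interpolation estimate, interior case: if `Π`
is linear, reproduces affine functions on `T`, and is orthotropically Orlicz-stable
from the patch `𝒩` to `T`, then
`⨍_T |V(∇w) − V(∇Πw)|² ≤ C' inf_q ⨍_𝒩 |V(∇w) − V(q)|²`, with `C'` depending only on
`c, C, D, K, C_S` (averages taken in `[0,∞]`). -/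
theorem statement15 (c C D K CS : ℝ) (hc : 0 < c) (hcC : c ≤ C) (hD : 0 < D)
    (hK : 1 ≤ K) (hCS : 0 < CS) :
    ∃ C' : ℝ, 0 < C' ∧
      ∀ (d : ℕ) (φ φ' φ'' : Fin d → ℝ → ℝ),
        (∀ i, IsNFunction (φ i) (φ' i)) →
        (∀ i, ContDiffOn ℝ 2 (φ i) (Set.Ioi 0)) →
        (∀ i, ∀ t : ℝ, 0 < t → HasDerivAt (φ i) (φ' i t) t) →
        (∀ i, ∀ t : ℝ, 0 < t → HasDerivAt (φ' i) (φ'' i t) t) →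
        (∀ i, Delta2 (φ i) D) →
        (∀ i, UniformlyConvex (φ' i) (φ'' i) c C) →
        ∀ (T 𝒩 : Set (Fin d → ℝ)),
          MeasurableSet T → MeasurableSet 𝒩 → T ⊆ 𝒩 →
          Bornology.IsBounded 𝒩 →
          0 < volume T → volume 𝒩 < ⊤ →
          volume 𝒩 ≤ ENNReal.ofReal K * volume T →
          ∀ Ph : ((Fin d → ℝ) → ℝ) → ((Fin d → ℝ) → ℝ),
            -- linearity on C¹ functions
            (∀ (a b : ℝ) (v₁ v₂ : (Fin d → ℝ) → ℝ), ContDiff ℝ 1 v₁ → ContDiff ℝ 1 v₂ →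
              Ph (fun x => a * v₁ x + b * v₂ x) = fun x => a * Ph v₁ x + b * Ph v₂ x) →
            -- Π maps C¹ functions to functions C¹ on a neighborhood of T
            (∀ v : (Fin d → ℝ) → ℝ, ContDiff ℝ 1 v →
              ∃ U : Set (Fin d → ℝ), IsOpen U ∧ T ⊆ U ∧ ContDiffOn ℝ 1 (Ph v) U) →
            -- (i) invariance: affine functions are reproduced on T
            (∀ (α : ℝ) (β : Fin d → ℝ), ∀ x ∈ T,
              Ph (fun y => α + ∑ i, β i * y i) x = α + ∑ i, β i * x i) →
            -- (ii) orthotropic Orlicz stability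
            (∀ v : (Fin d → ℝ) → ℝ, ContDiff ℝ 1 v → ∀ (i : Fin d) (a : ℝ), 0 ≤ a →
              (∫⁻ x in T, ENNReal.ofReal (shiftN (φ' i) a |pdI d i (Ph v) x|)) / volume T ≤
                ENNReal.ofReal CS *
                  ((∫⁻ x in 𝒩, ENNReal.ofReal (shiftN (φ' i) a |pdI d i v x|)) / volume 𝒩)) →
            ∀ w : (Fin d → ℝ) → ℝ, ContDiff ℝ 1 w →
              (∫⁻ x in T, ENNReal.ofReal
                  (∑ i, (Vof (φ' i) (pdI d i w x) - Vof (φ' i) (pdI d i (Ph w) x)) ^ 2)) /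
                  volume T ≤
                ENNReal.ofReal C' *
                  ⨅ q : Fin d → ℝ,
                    (∫⁻ x in 𝒩, ENNReal.ofReal
                        (∑ i, (Vof (φ' i) (pdI d i w x) - Vof (φ' i) (q i)) ^ 2)) /
                      volume 𝒩 := by
  obtain ⟨k, hk, hCk⟩ : ∃ k : ℕ, 1 ≤ k ∧ C ≤ ((2 * k + 1 : ℕ) : ℝ) := by
    obtain ⟨n, hn⟩ := exists_nat_ge C
    refine ⟨n + 1, by omega, hn.trans ?_⟩
    exact_mod_cast (by omega : n ≤ 2 * (n + 1) + 1)
  set A : ℝ := (k + 1) ^ 2 * 4 * (4 * 2 ^ (2 * k + 1)) with hA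
  set B : ℝ := 4 * 4 ^ (2 * k + 1) with hB
  have hA0 : 0 < A := by positivity
  have hB0 : 0 < B := by positivity
  have hK0 : 0 < K := by linarith
  refine ⟨2 * (K + A * (CS * B)), by positivity, ?_⟩
  intro d φ φ' φ'' hN _ _ hφ'' _ hUC T 𝒩 hT _ hTN _ _ _ hvol Ph hlin hreg haff hstab w hw
  rw [ENNReal.mul_iInf_of_ne (by positivity) ENNReal.ofReal_ne_top]
  refine le_iInf fun q => ?_
  have hdec : ∀ i, ∀ s t : ℝ, 0 < s → s ≤ t →
      φ' i t * s ^ (2 * k + 1) ≤ φ' i s * t ^ (2 * k + 1) := fun i s t hs hst =>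
    mul_pow_le_mul_pow_of_mul_deriv_le (hφ'' i) (fun x hx => ((hUC i x hx).2).trans
      (mul_le_mul_of_nonneg_right hCk ((hN i).deriv_pos x hx).le)) hs hst
  have hequiv := fun i => shiftN_equiv_Vof_sub_sq (hN i).deriv_zero (hN i).deriv_mono hk (hdec i)
  have hVm : ∀ i, Measurable (Vof (φ' i)) := fun i =>
    (monotone_Vof (hN i).deriv_zero (hN i).deriv_mono).measurable
  have hVw : ∀ i (g : (Fin d → ℝ) → ℝ), Measurable fun x => Vof (φ' i) (pdI d i g x) :=
    fun i g => (hVm i).comp (measurable_pdI i g)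
  have hsum : ∀ (S : Set (Fin d → ℝ)) (G : Fin d → (Fin d → ℝ) → ℝ), (∀ i, Measurable (G i)) →
      (∫⁻ x in S, ENNReal.ofReal (∑ i, (G i x) ^ 2)) / volume S =
        ∑ i, (∫⁻ x in S, ENNReal.ofReal ((G i x) ^ 2)) / volume S := by
    intro S G hG
    simp_rw [ENNReal.ofReal_sum_of_nonneg fun i _ => sq_nonneg (G i _)]
    rw [lintegral_finsetSum _ fun i _ => ((hG i).pow_const 2).ennreal_ofReal]
    simp_rw [div_eq_mul_inv, Finset.sum_mul]
  rw [hsum T (fun i x => Vof (φ' i) (pdI d i w x) - Vof (φ' i) (pdI d i (Ph w) x))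
      fun i => (hVw i w).sub (hVw i (Ph w)),
    hsum 𝒩 (fun i x => Vof (φ' i) (pdI d i w x) - Vof (φ' i) (q i))
      fun i => (hVw i w).sub_const _, Finset.mul_sum]
  refine Finset.sum_le_sum fun i _ => ?_
  set I : ENNReal := (∫⁻ x in 𝒩, ENNReal.ofReal
    ((Vof (φ' i) (pdI d i w x) - Vof (φ' i) (q i)) ^ 2)) / volume 𝒩 with hI
  set v : (Fin d → ℝ) → ℝ := fun y => w y - ∑ j, q j * y j with hv
  have hvc : ContDiff ℝ 1 v := hw.sub (contDiff_sum_mul q)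
  have hpv : ∀ x, pdI d i v x = pdI d i w x - q i := by
    intro x
    have h := pdI_add i (x := x) (hvc.differentiable one_ne_zero x)
      ((contDiff_sum_mul q).differentiable one_ne_zero x)
    rw [pdI_sum_mul] at h
    simp only [hv, sub_add_cancel] at h ⊢
    exact eq_sub_of_add_eq h.symm
  have h1 : (∫⁻ x in T, ENNReal.ofReal ((Vof (φ' i) (pdI d i w x) - Vof (φ' i) (q i)) ^ 2)) /
      volume T ≤ ENNReal.ofReal K * I :=
    setLIntegral_div_le_of_subset hTN hK0 hvol _
  have h2 : (∫⁻ x in T, ENNReal.ofReal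
      ((Vof (φ' i) (pdI d i (Ph w) x) - Vof (φ' i) (q i)) ^ 2)) / volume T ≤
        ENNReal.ofReal (A * (CS * B)) * I := by
    have hup : (∫⁻ x in T, ENNReal.ofReal
        ((Vof (φ' i) (pdI d i (Ph w) x) - Vof (φ' i) (q i)) ^ 2)) ≤
          ENNReal.ofReal A *
            ∫⁻ x in T, ENNReal.ofReal (shiftN (φ' i) |q i| |pdI d i (Ph v) x|) := by
      rw [← lintegral_const_mul' _ _ ENNReal.ofReal_ne_top]
      refine lintegral_mono_ae ?_
      filter_upwards [ae_pdI_sub_linear hT hlin hreg haff hw q i] with x hx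
      rw [hx, ← ENNReal.ofReal_mul hA0.le]
      exact ENNReal.ofReal_le_ofReal (hequiv i _ _).2
    have hlow : (∫⁻ x in 𝒩, ENNReal.ofReal (shiftN (φ' i) |q i| |pdI d i v x|)) / volume 𝒩 ≤
        ENNReal.ofReal B * I := by
      rw [hI, ← mul_div_assoc, ← lintegral_const_mul' _ _ ENNReal.ofReal_ne_top]
      refine ENNReal.div_le_div_right (lintegral_mono fun x => ?_) _
      rw [hpv x, ← ENNReal.ofReal_mul hB0.le]
      exact ENNReal.ofReal_le_ofReal (hequiv i _ _).1
    calc _ ≤ (ENNReal.ofReal A *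
            ∫⁻ x in T, ENNReal.ofReal (shiftN (φ' i) |q i| |pdI d i (Ph v) x|)) / volume T :=
          ENNReal.div_le_div_right hup _
      _ ≤ ENNReal.ofReal A * (ENNReal.ofReal CS * (ENNReal.ofReal B * I)) := by
          rw [mul_div_assoc]
          exact mul_le_mul_right ((hstab v hvc i _ (abs_nonneg _)).trans
            (mul_le_mul_right hlow _)) _
      _ = _ := by
          rw [ENNReal.ofReal_mul hA0.le, ENNReal.ofReal_mul hCS.le]; ring
  have hle : ∀ x, ENNReal.ofReal
      ((Vof (φ' i) (pdI d i w x) - Vof (φ' i) (pdI d i (Ph w) x)) ^ 2) ≤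
        2 * (ENNReal.ofReal ((Vof (φ' i) (pdI d i w x) - Vof (φ' i) (q i)) ^ 2) +
          ENNReal.ofReal ((Vof (φ' i) (pdI d i (Ph w) x) - Vof (φ' i) (q i)) ^ 2)) := by
    intro x
    rw [← ENNReal.ofReal_add (sq_nonneg _) (sq_nonneg _), ← ENNReal.ofReal_ofNat 2,
      ← ENNReal.ofReal_mul zero_le_two]
    refine ENNReal.ofReal_le_ofReal ?_
    nlinarith [sq_nonneg (Vof (φ' i) (pdI d i w x) - Vof (φ' i) (q i) +
      (Vof (φ' i) (pdI d i (Ph w) x) - Vof (φ' i) (q i)))]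
  calc _ ≤ (∫⁻ x in T,
        2 * (ENNReal.ofReal ((Vof (φ' i) (pdI d i w x) - Vof (φ' i) (q i)) ^ 2) +
          ENNReal.ofReal ((Vof (φ' i) (pdI d i (Ph w) x) - Vof (φ' i) (q i)) ^ 2))) /
            volume T := ENNReal.div_le_div_right (lintegral_mono hle) _
    _ ≤ 2 * (ENNReal.ofReal K * I + ENNReal.ofReal (A * (CS * B)) * I) := by
        rw [lintegral_const_mul' _ _ ENNReal.ofNat_ne_top,
          lintegral_add_left (((hVw i w).sub_const _).pow_const 2).ennreal_ofReal,
          mul_div_assoc, ENNReal.add_div]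
        exact mul_le_mul_right (add_le_add h1 h2) _
    _ = _ := by
        rw [ENNReal.ofReal_mul zero_le_two, ENNReal.ofReal_add hK0.le (by positivity),
          ENNReal.ofReal_ofNat]
        ring
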